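/- Let q be a prime, let λ : ℕ≥1 → ℂ satisfy the normalized Hecke relations with constants C > 0 and A ≥ 0 such that |λ(n)| ≤ C·n^A for all n ≥ 1, let ν ∈ ℂ, and let τ₁ ∈ ℂ. Define ρ : ℕ≥1 → ℂ by ρ(n) = τ₁·q^{1/2}·λ(n/q) if q ∣ n and ρ(n) = 0 otherwise. Then for every s ∈ ℂ with Re s > 1 + A + max(0, Re ν) one has ∑_{n≥1} ρ(n) σ_ν(n) n^{−s} = τ₁ · q^{1/2−s} · (1 + q^ν − λ(q) q^{ν−s})/(1 − q^{ν−2s}) · L(s)·L(s−ν)/ζ(2s−ν), where L(w) = ∑_{n≥1} λ(n) n^{−w} and ζ is the Riemann zeta function; in this region |q^{ν−2s}| < 1 so the denominator is nonzero. -/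

import Mathlib

/-- The complex divisor sum `σ_ν(n) = ∑_{d ∣ n} d^ν`. -/
noncomputable def csigma (ν : ℂ) (n : ℕ) : ℂ := ∑ d ∈ n.divisors, (d : ℂ) ^ ν

/-- The Dirichlet series `L(w) = ∑_{n ≥ 1} l n * n ^ (-w)` attached to `l`. -/
noncomputable def Lfun (l : ℕ → ℂ) (w : ℂ) : ℂ :=
  ∑' n : ℕ, if n = 0 then 0 else l n * (n : ℂ) ^ (-w)

/-- The power function `n ↦ n ^ ν` as an arithmetic function. -/
noncomputable def cpowArith (ν : ℂ) : ArithmeticFunction ℂ :=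
  toArithmeticFunction fun n ↦ (n : ℂ) ^ ν

/-- The arithmetic function supported on squares with value `d ^ ν` at `d ^ 2`. -/
noncomputable def squareCpowArith (ν : ℂ) : ArithmeticFunction ℂ :=
  toArithmeticFunction fun n ↦ if IsSquare n then (n.sqrt : ℂ) ^ ν else 0

lemma toArithmeticFunction_apply_of_ne_zero {f : ℕ → ℂ} {n : ℕ} (hn : n ≠ 0) :
    toArithmeticFunction f n = f n := by
  simp [toArithmeticFunction, hn]

lemma LSeries_toArithmeticFunction (f : ℕ → ℂ) (s : ℂ) :
    LSeries (toArithmeticFunction f) s = LSeries f s :=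
  LSeries_congr (fun hn ↦ toArithmeticFunction_apply_of_ne_zero hn) s

lemma LSeriesSummable_toArithmeticFunction {f : ℕ → ℂ} {s : ℂ} :
    LSeriesSummable (toArithmeticFunction f) s ↔ LSeriesSummable f s :=
  LSeriesSummable_congr s fun hn ↦ toArithmeticFunction_apply_of_ne_zero hn

lemma isMultiplicative_toArithmeticFunction {f : ℕ → ℂ} (h1 : f 1 = 1)
    (hmul : ∀ m n : ℕ, 1 ≤ m → 1 ≤ n → Nat.Coprime m n → f (m * n) = f m * f n) :
    (toArithmeticFunction f).IsMultiplicative := by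
  refine ArithmeticFunction.IsMultiplicative.iff_ne_zero.2
    ⟨by rw [toArithmeticFunction_apply_of_ne_zero one_ne_zero, h1], fun {m n} hm hn h ↦ ?_⟩
  rw [toArithmeticFunction_apply_of_ne_zero hm, toArithmeticFunction_apply_of_ne_zero hn,
    toArithmeticFunction_apply_of_ne_zero (mul_ne_zero hm hn),
    hmul m n (Nat.one_le_iff_ne_zero.2 hm) (Nat.one_le_iff_ne_zero.2 hn) h]

lemma isMultiplicative_cpowArith (ν : ℂ) : (cpowArith ν).IsMultiplicative :=
  isMultiplicative_toArithmeticFunction (by simp) fun m n _ _ _ ↦ by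
    push_cast
    exact Complex.natCast_mul_natCast_cpow m n ν

lemma isMultiplicative_squareCpowArith (ν : ℂ) : (squareCpowArith ν).IsMultiplicative := by
  refine isMultiplicative_toArithmeticFunction (by simp) fun m n _ _ h ↦ ?_
  by_cases hs : IsSquare (m * n)
  · obtain ⟨c, hc⟩ := hs
    obtain ⟨a, rfl⟩ := exists_eq_pow_of_mul_eq_pow (k := 2) (Nat.isUnit_iff.2 h)
      (hc.trans (sq c).symm)
    obtain ⟨b, rfl⟩ := exists_eq_pow_of_mul_eq_pow (k := 2) (Nat.isUnit_iff.2 h.symm)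
      ((mul_comm _ _).trans (hc.trans (sq c).symm))
    rw [← mul_pow, if_pos (IsSquare.sq _), if_pos (IsSquare.sq _), if_pos (IsSquare.sq _),
      Nat.sqrt_eq', Nat.sqrt_eq', Nat.sqrt_eq', Nat.cast_mul, Complex.natCast_mul_natCast_cpow]
  · rw [if_neg hs]
    by_cases hm : IsSquare m
    · rw [if_neg fun hn ↦ hs (hm.mul hn), mul_zero]
    · rw [if_neg hm, zero_mul]

lemma csigma_eq_mul_apply (ν : ℂ) (n : ℕ) :
    csigma ν n = ((ArithmeticFunction.zeta : ArithmeticFunction ℂ) * cpowArith ν) n := by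
  rw [ArithmeticFunction.coe_zeta_mul_apply, csigma]
  refine Finset.sum_congr rfl fun d hd ↦ ?_
  rw [cpowArith, toArithmeticFunction_apply_of_ne_zero (Nat.pos_of_mem_divisors hd).ne']

lemma isMultiplicative_zeta_mul_cpowArith (ν : ℂ) :
    ((ArithmeticFunction.zeta : ArithmeticFunction ℂ) * cpowArith ν).IsMultiplicative :=
  ArithmeticFunction.isMultiplicative_zeta.natCast.mul (isMultiplicative_cpowArith ν)

lemma natCast_pow_cpow (p k : ℕ) (ν : ℂ) : ((p ^ k : ℕ) : ℂ) ^ ν = ((p : ℂ) ^ ν) ^ k := by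
  induction k with
  | zero => simp
  | succ k ih => rw [pow_succ, Nat.cast_mul, Complex.natCast_mul_natCast_cpow, ih, pow_succ]

lemma csigma_prime_pow (ν : ℂ) {p : ℕ} (hp : p.Prime) (k : ℕ) :
    csigma ν (p ^ k) = ∑ i ∈ Finset.range (k + 1), ((p : ℂ) ^ ν) ^ i := by
  rw [csigma, Nat.sum_divisors_prime_pow hp]
  exact Finset.sum_congr rfl fun i _ ↦ natCast_pow_cpow p i ν

lemma ArithmeticFunction.mul_apply_prime_pow (f g : ArithmeticFunction ℂ) {p : ℕ} (hp : p.Prime)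
    (k : ℕ) :
    (f * g) (p ^ k) = ∑ x ∈ Finset.HasAntidiagonal.antidiagonal k, f (p ^ x.1) * g (p ^ x.2) := by
  rw [ArithmeticFunction.mul_apply, Nat.sum_divisorsAntidiagonal (fun x y ↦ f x * g y),
    Nat.sum_divisors_prime_pow hp,
    Finset.Nat.sum_antidiagonal_eq_sum_range_succ (fun i j ↦ f (p ^ i) * g (p ^ j))]
  refine Finset.sum_congr rfl fun i hi ↦ ?_
  rw [Nat.pow_div (Finset.mem_range_succ_iff.1 hi) hp.pos]

/-- The Hecke product rule at a prime, for neighbouring indices. -/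
lemma hecke_mul_sub_mul {u : ℕ → ℂ} (hu : ∀ k, u (k + 2) = u 1 * u (k + 1) - u k) (i j : ℕ)
    (h0 : u 0 = 1) : u (i + 1) * u (j + 1) - u i * u j = u (i + j + 2) := by
  induction j generalizing i with
  | zero => rw [add_zero, hu, h0]; ring
  | succ j ih =>
    have := ih (i + 1)
    rw [show i + (j + 1) + 2 = i + 1 + j + 2 by ring, ← this, hu j, hu i]
    ring

lemma sum_antidiagonal_hecke {u : ℕ → ℂ} (h0 : u 0 = 1)
    (hu : ∀ k, u (k + 2) = u 1 * u (k + 1) - u k) (x : ℂ) (k : ℕ) :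
    ∑ a ∈ Finset.HasAntidiagonal.antidiagonal k, (if Even a.1 then x ^ (a.1 / 2) else 0) *
        (u a.2 * ∑ i ∈ Finset.range (a.2 + 1), x ^ i) =
      ∑ a ∈ Finset.HasAntidiagonal.antidiagonal k, u a.1 * (u a.2 * x ^ a.2) := by
  induction k using Nat.twoStepInduction with
  | zero => simp [h0]
  | one => simp [Finset.Nat.antidiagonal_succ, Finset.sum_range_succ, h0]; ring
  | more k ih _ =>
    have hl : ∑ a ∈ Finset.HasAntidiagonal.antidiagonal (k + 2), (if Even a.1 then x ^ (a.1 / 2) else 0) *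
        (u a.2 * ∑ i ∈ Finset.range (a.2 + 1), x ^ i) =
        u (k + 2) * ∑ i ∈ Finset.range (k + 3), x ^ i +
        x * ∑ a ∈ Finset.HasAntidiagonal.antidiagonal k, (if Even a.1 then x ^ (a.1 / 2) else 0) *
          (u a.2 * ∑ i ∈ Finset.range (a.2 + 1), x ^ i) := by
      rw [Finset.Nat.sum_antidiagonal_succ, Finset.Nat.sum_antidiagonal_succ]
      simp only [zero_add, Nat.not_even_one, if_false, zero_mul, Even.zero, if_true, Nat.zero_div,
        pow_zero, one_mul]
      congr 1
      rw [Finset.mul_sum]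
      refine Finset.sum_congr rfl fun a _ ↦ ?_
      rw [show a.1 + 1 + 1 = a.1 + 2 by ring, Nat.add_div_right _ two_pos]
      by_cases he : Even a.1
      · rw [if_pos he, if_pos (he.add even_two)]; ring
      · rw [if_neg he, if_neg (by simpa [Nat.even_add] using he)]; ring
    have hm : ∑ a ∈ Finset.HasAntidiagonal.antidiagonal k, u (a.1 + 1) * (u (a.2 + 1) * x ^ (a.2 + 1)) =
        x * ∑ a ∈ Finset.HasAntidiagonal.antidiagonal k, u a.1 * (u a.2 * x ^ a.2) +
          u (k + 2) * ∑ i ∈ Finset.range (k + 1), x ^ (i + 1) := by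
      rw [← Finset.sum_range_reflect,
        ← Finset.Nat.sum_antidiagonal_eq_sum_range_succ_mk (fun a ↦ x ^ (k + 1 - 1 - a.1 + 1)),
        Finset.mul_sum, Finset.mul_sum, ← Finset.sum_add_distrib]
      refine Finset.sum_congr rfl fun a ha ↦ ?_
      rw [Finset.HasAntidiagonal.mem_antidiagonal] at ha
      subst ha
      rw [← hecke_mul_sub_mul hu _ _ h0, show a.1 + a.2 + 1 - 1 - a.1 = a.2 by lia]
      ring
    rw [hl, ih, Finset.Nat.antidiagonal_succ_succ', Finset.sum_cons, Finset.sum_cons,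
      Finset.sum_map]
    simp only [Function.Embedding.prodMap, Function.Embedding.coeFn_mk, Prod.map,
      Nat.succ_eq_add_one]
    rw [hm, Finset.sum_range_succ', Finset.sum_range_succ, h0]
    ring

/-- The arithmetic form of the Ramanujan-type identity
`ζ(2s - ν) ∑ l n σ_ν(n) n ^ (-s) = L(s) L(s - ν)`. -/
lemma squareCpowArith_mul_pmul {l : ℕ → ℂ} (h1 : l 1 = 1)
    (hmul : ∀ m n : ℕ, 1 ≤ m → 1 ≤ n → Nat.Coprime m n → l (m * n) = l m * l n)
    (hrec : ∀ p : ℕ, p.Prime → ∀ k : ℕ, 1 ≤ k →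
      l (p ^ (k + 1)) = l p * l (p ^ k) - l (p ^ (k - 1))) (ν : ℂ) :
    squareCpowArith ν * (toArithmeticFunction l).pmul
        ((ArithmeticFunction.zeta : ArithmeticFunction ℂ) * cpowArith ν) =
      toArithmeticFunction l * (toArithmeticFunction l).pmul (cpowArith ν) := by
  have hl := isMultiplicative_toArithmeticFunction h1 hmul
  refine (ArithmeticFunction.IsMultiplicative.eq_iff_eq_on_prime_powers _
    ((isMultiplicative_squareCpowArith ν).mul (hl.pmul (isMultiplicative_zeta_mul_cpowArith ν))) _
    (hl.mul (hl.pmul (isMultiplicative_cpowArith ν)))).2 fun p k hp ↦ ?_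
  have hpk (i : ℕ) : p ^ i ≠ 0 := pow_ne_zero i hp.ne_zero
  rw [ArithmeticFunction.mul_apply_prime_pow _ _ hp, ArithmeticFunction.mul_apply_prime_pow _ _ hp]
  have key := sum_antidiagonal_hecke (u := fun k ↦ l (p ^ k)) (by simpa using h1)
    (fun k ↦ by simpa using hrec p hp (k + 1) (by lia)) ((p : ℂ) ^ ν) k
  convert key using 3 with a _ a _
  · rw [squareCpowArith, toArithmeticFunction_apply_of_ne_zero (hpk _)]
    by_cases he : Even a.1
    · obtain ⟨i, hi⟩ := he
      rw [hi, pow_add, if_pos ⟨_, rfl⟩, if_pos ⟨_, rfl⟩, Nat.sqrt_eq, natCast_pow_cpow,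
        show (i + i) / 2 = i by lia]
    · rw [if_neg he, if_neg]
      rintro ⟨r, hr⟩
      obtain ⟨i, -, rfl⟩ := (Nat.dvd_prime_pow hp).1 (Dvd.intro r hr.symm)
      rw [← pow_add] at hr
      exact he ⟨i, Nat.pow_right_injective hp.two_le hr⟩
  · rw [ArithmeticFunction.pmul_apply, toArithmeticFunction_apply_of_ne_zero (hpk _),
      ← csigma_eq_mul_apply, csigma_prime_pow ν hp]
  · rw [toArithmeticFunction_apply_of_ne_zero (hpk _)]
  · rw [ArithmeticFunction.pmul_apply, cpowArith, toArithmeticFunction_apply_of_ne_zero (hpk _),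
      toArithmeticFunction_apply_of_ne_zero (hpk _), natCast_pow_cpow]

lemma LSeriesHasSum_squareCpowArith {ν s : ℂ} (hs : 1 < (2 * s - ν).re) :
    LSeriesHasSum (squareCpowArith ν) s (riemannZeta (2 * s - ν)) := by
  have hsum : HasSum (fun n : ℕ ↦ 1 / (n : ℂ) ^ (2 * s - ν)) (riemannZeta (2 * s - ν)) := by
    rw [zeta_eq_tsum_one_div_nat_cpow hs]
    exact (Complex.summable_one_div_nat_cpow.2 hs).hasSum
  have hinj : Function.Injective fun n : ℕ ↦ n * n := fun a b h ↦ Nat.mul_self_inj.1 h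
  refine (hinj.hasSum_iff fun n hn ↦ ?_).1 (hsum.congr_fun fun n ↦ ?_)
  · rcases eq_or_ne n 0 with rfl | hn0
    · simp
    rw [LSeries.term_of_ne_zero hn0, squareCpowArith, toArithmeticFunction_apply_of_ne_zero hn0,
      if_neg fun ⟨r, hr⟩ ↦ hn ⟨r, hr.symm⟩, zero_div]
  · rcases eq_or_ne n 0 with rfl | hn
    · have h0 : 2 * s - ν ≠ 0 := fun h ↦ by simp [h] at hs; linarith
      simp [Complex.zero_cpow h0]
    have hnn := mul_ne_zero hn hn
    rw [Function.comp_apply, LSeries.term_of_ne_zero hnn, squareCpowArith,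
      toArithmeticFunction_apply_of_ne_zero hnn, if_pos ⟨n, rfl⟩, Nat.sqrt_eq, Nat.cast_mul,
      Complex.natCast_mul_natCast_cpow, Complex.cpow_sub _ _ (Nat.cast_ne_zero.2 hn), two_mul,
      Complex.cpow_add _ _ (Nat.cast_ne_zero.2 hn), one_div_div]

/-- A multiplicative function whose values at powers of `p` satisfy a two-term recurrence
satisfies the corresponding recurrence at all multiples of `p`. -/
lemma apply_prime_mul {f : ℕ → ℂ} {p : ℕ} (hp : p.Prime) {c : ℂ} (h1 : f 1 = 1)
    (hmul : ∀ m n : ℕ, 1 ≤ m → 1 ≤ n → Nat.Coprime m n → f (m * n) = f m * f n)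
    (hrec : ∀ k : ℕ, f (p ^ (k + 2)) = f p * f (p ^ (k + 1)) - c * f (p ^ k))
    {m : ℕ} (hm : m ≠ 0) :
    f (p * m) = f p * f m - if p ∣ m then c * f (m / p) else 0 := by
  obtain ⟨k, r, hr, rfl⟩ := Nat.exists_eq_pow_mul_and_not_dvd hm p hp.ne_one
  have hr1 : 1 ≤ r := Nat.one_le_iff_ne_zero.2 fun h ↦ hr (h ▸ dvd_zero p)
  have hf (i : ℕ) : f (p ^ i * r) = f (p ^ i) * f r :=
    hmul _ _ (Nat.one_le_pow _ _ hp.pos) hr1 (((hp.coprime_iff_not_dvd).2 hr).pow_left i)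
  rw [← mul_assoc, ← pow_succ', hf, hf]
  cases k with
  | zero => simp [hr, h1]
  | succ k =>
    rw [if_pos (Dvd.dvd.mul_right (dvd_pow_self p k.succ_ne_zero) r), pow_succ' p k, mul_assoc,
      Nat.mul_div_cancel_left _ hp.pos, hf, ← pow_succ', hrec]
    ring

lemma csigma_prime_mul (ν : ℂ) {p : ℕ} (hp : p.Prime) {m : ℕ} (hm : m ≠ 0) :
    csigma ν (p * m) = (1 + (p : ℂ) ^ ν) * csigma ν m -
      if p ∣ m then (p : ℂ) ^ ν * csigma ν (m / p) else 0 := by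
  have hmult := isMultiplicative_zeta_mul_cpowArith ν
  have hσp : csigma ν p = 1 + (p : ℂ) ^ ν := by
    simpa [Finset.sum_range_succ] using csigma_prime_pow ν hp 1
  rw [← hσp]
  refine apply_prime_mul hp (by simp [csigma]) (fun m n _ _ h ↦ ?_) (fun k ↦ ?_) hm
  · simp only [csigma_eq_mul_apply]
    exact hmult.map_mul_of_coprime h
  · rw [hσp, csigma_prime_pow ν hp, csigma_prime_pow ν hp, csigma_prime_pow ν hp,
      Finset.sum_range_succ _ (k + 2), Finset.sum_range_succ _ (k + 1)]
    ring

lemma hasSum_ite_dvd_iff {f : ℕ → ℂ} {q : ℕ} (hq : q ≠ 0) {a : ℂ} :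
    HasSum (fun n ↦ if q ∣ n then f (n / q) else 0) a ↔ HasSum f a := by
  have hinj : Function.Injective fun n : ℕ ↦ q * n := mul_right_injective₀ hq
  rw [← hinj.hasSum_iff fun n hn ↦ if_neg fun ⟨m, hm⟩ ↦ hn ⟨m, hm.symm⟩]
  simp [Function.comp_def, Nat.pos_of_ne_zero hq]

lemma LSeriesSummable_cpow {ν w : ℂ} (hw : 1 + ν.re < w.re) :
    LSeriesSummable (fun n ↦ (n : ℂ) ^ ν) w :=
  LSeriesSummable_of_le_const_mul_rpow hw ⟨1, fun n hn ↦ by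
    rw [Complex.norm_natCast_cpow_of_pos (Nat.pos_of_ne_zero hn), one_mul, add_sub_cancel_left]⟩

lemma LSeries_term_eq {f : ℕ → ℂ} {s : ℂ} {n : ℕ} :
    LSeries.term f s n = if n = 0 then 0 else f n * (n : ℂ) ^ (-s) := by
  rw [LSeries.term_def, Complex.cpow_neg]
  rfl

lemma Lfun_eq_LSeries (l : ℕ → ℂ) (w : ℂ) : Lfun l w = LSeries l w := by
  simp only [Lfun, LSeries, LSeries_term_eq]

lemma LSeriesSummable_csigma {ν w : ℂ} (hw : 1 + max 0 ν.re < w.re) :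
    LSeriesSummable (csigma ν) w := by
  have h0 := le_max_left 0 ν.re
  have hν := le_max_right 0 ν.re
  have := ArithmeticFunction.LSeriesSummable_mul
    (f := (ArithmeticFunction.zeta : ArithmeticFunction ℂ)) (g := cpowArith ν) (s := w)
    (ArithmeticFunction.LSeriesSummable_zeta_iff.2 (by linarith))
    (LSeriesSummable_toArithmeticFunction.2 (LSeriesSummable_cpow (ν := ν) (by linarith)))
  exact (LSeriesSummable_congr w fun _ ↦ csigma_eq_mul_apply ν _).2 this

lemma summable_mul_csigma_mul {l : ℕ → ℂ} {C A : ℝ}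
    (hbd : ∀ n : ℕ, 1 ≤ n → ‖l n‖ ≤ C * (n : ℝ) ^ A) {ν s : ℂ}
    (hs : 1 + A + max 0 ν.re < s.re) {N : ℕ} (hN : N ≠ 0) :
    Summable fun m : ℕ ↦ l m * csigma ν (N * m) * (m : ℂ) ^ (-s) := by
  have hσ : LSeriesSummable (csigma ν) (s - A) :=
    LSeriesSummable_csigma (by simp; linarith)
  have hinj : Function.Injective fun n : ℕ ↦ N * n := mul_right_injective₀ hN
  refine Summable.of_norm_bounded
    (((hσ.norm.comp_injective hinj).mul_left (C * (N : ℝ) ^ (s.re - A)))) fun m ↦ ?_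
  rcases eq_or_ne m 0 with rfl | hm
  · simp [csigma]
  have hm0 := Nat.pos_of_ne_zero hm
  have hN0 := Nat.pos_of_ne_zero hN
  have hmR : (0 : ℝ) < m := Nat.cast_pos.2 hm0
  have hNR : (0 : ℝ) < N := Nat.cast_pos.2 hN0
  rw [Function.comp_apply, LSeries.term_of_ne_zero (mul_ne_zero hN hm), norm_mul, norm_mul,
    norm_div, Complex.norm_natCast_cpow_of_pos hm0,
    Complex.norm_natCast_cpow_of_pos (Nat.mul_pos hN0 hm0), Nat.cast_mul,
    Real.mul_rpow hNR.le hmR.le]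
  have hre : (s - (A : ℂ)).re = s.re - A := by simp
  have hNne := (Real.rpow_pos_of_pos hNR (s.re - A)).ne'
  calc ‖l m‖ * ‖csigma ν (N * m)‖ * (m : ℝ) ^ (-s).re
      ≤ C * (m : ℝ) ^ A * ‖csigma ν (N * m)‖ * (m : ℝ) ^ (-s).re := by
        gcongr
        exact hbd m hm0
    _ = _ := by
        rw [hre, Real.rpow_sub hmR, Complex.neg_re, Real.rpow_neg hmR.le]
        have := (Real.rpow_pos_of_pos hmR A).ne'
        have := (Real.rpow_pos_of_pos hmR s.re).ne'
        field_simp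

/-- The Ramanujan-type identity `∑ l n σ_ν(n) n ^ (-s) = L(s) L(s - ν) / ζ(2s - ν)`. -/
lemma tsum_mul_csigma {l : ℕ → ℂ} {C A : ℝ} (hA : 0 ≤ A) (h1 : l 1 = 1)
    (hmul : ∀ m n : ℕ, 1 ≤ m → 1 ≤ n → Nat.Coprime m n → l (m * n) = l m * l n)
    (hrec : ∀ p : ℕ, p.Prime → ∀ k : ℕ, 1 ≤ k →
      l (p ^ (k + 1)) = l p * l (p ^ k) - l (p ^ (k - 1)))
    (hbd : ∀ n : ℕ, 1 ≤ n → ‖l n‖ ≤ C * (n : ℝ) ^ A) {ν s : ℂ}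
    (hs : 1 + A + max 0 ν.re < s.re) :
    ∑' n : ℕ, l n * csigma ν n * (n : ℂ) ^ (-s) =
      Lfun l s * Lfun l (s - ν) / riemannZeta (2 * s - ν) := by
  have h0 := le_max_left 0 ν.re
  have hν := le_max_right 0 ν.re
  have hre : 1 < (2 * s - ν).re := by simp; linarith
  have hterm (n : ℕ) : l n * csigma ν n * (n : ℂ) ^ (-s) = LSeries.term
      ((toArithmeticFunction l).pmul
        ((ArithmeticFunction.zeta : ArithmeticFunction ℂ) * cpowArith ν)) s n := by
    rcases eq_or_ne n 0 with rfl | hn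
    · simp [csigma]
    · rw [LSeries_term_eq, if_neg hn, ArithmeticFunction.pmul_apply,
        toArithmeticFunction_apply_of_ne_zero hn, csigma_eq_mul_apply]
  have hterm' (n : ℕ) : LSeries.term ((toArithmeticFunction l).pmul (cpowArith ν)) s n =
      LSeries.term l (s - ν) n := by
    rcases eq_or_ne n 0 with rfl | hn
    · simp
    · rw [LSeries.term_of_ne_zero hn, LSeries.term_of_ne_zero hn, ArithmeticFunction.pmul_apply,
        cpowArith, toArithmeticFunction_apply_of_ne_zero hn,
        toArithmeticFunction_apply_of_ne_zero hn, Complex.cpow_sub _ _ (Nat.cast_ne_zero.2 hn),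
        div_div_eq_mul_div]
  have hl {w : ℂ} (hw : 1 + A < w.re) : LSeriesSummable l w :=
    LSeriesSummable_of_le_const_mul_rpow hw ⟨C, fun n hn ↦ by
      simpa using hbd n (Nat.one_le_iff_ne_zero.2 hn)⟩
  have hD : LSeriesSummable ((toArithmeticFunction l).pmul
        ((ArithmeticFunction.zeta : ArithmeticFunction ℂ) * cpowArith ν)) s :=
    (summable_mul_csigma_mul hbd hs one_ne_zero).congr fun n ↦ by
      rw [one_mul, hterm]
  have hζ := LSeriesHasSum_squareCpowArith hre
  have hlν : LSeriesSummable l (s - ν) := hl (by simp; linarith)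
  have key := ArithmeticFunction.LSeries_mul' hζ.LSeriesSummable hD
  rw [squareCpowArith_mul_pmul h1 hmul hrec, ArithmeticFunction.LSeries_mul'
    (LSeriesSummable_toArithmeticFunction.2 (hl (by linarith)))
    (hlν.congr fun n ↦ (hterm' n).symm), hζ.LSeries_eq, LSeries_toArithmeticFunction] at key
  rw [Lfun_eq_LSeries, Lfun_eq_LSeries, eq_div_iff (riemannZeta_ne_zero_of_one_lt_re hre),
    tsum_congr hterm, show LSeries l (s - ν) = _ from (tsum_congr hterm').symm]
  exact (key.trans (mul_comm _ _)).symm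

/-- The series `∑ l m σ_ν(q m) m ^ (-s)` as a multiple of `∑ l m σ_ν(m) m ^ (-s)`. -/
lemma one_sub_mul_tsum_mul_csigma_prime_mul {l : ℕ → ℂ} {q : ℕ} (hq : q.Prime) {C A : ℝ}
    (h1 : l 1 = 1)
    (hmul : ∀ m n : ℕ, 1 ≤ m → 1 ≤ n → Nat.Coprime m n → l (m * n) = l m * l n)
    (hrec : ∀ k : ℕ, 1 ≤ k → l (q ^ (k + 1)) = l q * l (q ^ k) - l (q ^ (k - 1)))
    (hbd : ∀ n : ℕ, 1 ≤ n → ‖l n‖ ≤ C * (n : ℝ) ^ A) {ν s : ℂ}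
    (hs : 1 + A + max 0 ν.re < s.re) :
    (1 - (q : ℂ) ^ (ν - 2 * s)) * ∑' m : ℕ, l m * csigma ν (q * m) * (m : ℂ) ^ (-s) =
      (1 + (q : ℂ) ^ ν - l q * (q : ℂ) ^ (ν - s)) *
        ∑' m : ℕ, l m * csigma ν m * (m : ℂ) ^ (-s) := by
  have hq0 := hq.ne_zero
  set a : ℕ → ℂ := fun m ↦ l m * csigma ν (q * m) * (m : ℂ) ^ (-s) with ha_def
  set d : ℕ → ℂ := fun m ↦ l m * csigma ν m * (m : ℂ) ^ (-s) with hd_def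
  set e : ℕ → ℂ := fun m ↦ l (q * m) * csigma ν m * (m : ℂ) ^ (-s) with he_def
  have ha : HasSum a (∑' m, a m) := (summable_mul_csigma_mul hbd hs hq0).hasSum
  have hd : HasSum d (∑' m, d m) := by
    simpa [hd_def] using (summable_mul_csigma_mul hbd hs one_ne_zero).hasSum
  have hcpow (m : ℕ) : ((q * m : ℕ) : ℂ) ^ (-s) = (q : ℂ) ^ (-s) * (m : ℂ) ^ (-s) := by
    rw [Nat.cast_mul, Complex.natCast_mul_natCast_cpow]
  have hrec' (k : ℕ) : l (q ^ (k + 2)) = l q * l (q ^ (k + 1)) - 1 * l (q ^ k) := by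
    simpa using hrec (k + 1) (by lia)
  have he : HasSum e (l q * ∑' m, d m - (q : ℂ) ^ (-s) * ∑' m, a m) := by
    refine ((hd.mul_left (l q)).sub
      (((hasSum_ite_dvd_iff hq0).2 ha).mul_left ((q : ℂ) ^ (-s)))).congr_fun fun m ↦ ?_
    rcases eq_or_ne m 0 with rfl | hm
    · simp [ha_def, hd_def, he_def, csigma]
    simp only [he_def, hd_def, apply_prime_mul hq h1 hmul hrec' hm]
    by_cases hdvd : q ∣ m
    · obtain ⟨m, rfl⟩ := hdvd
      simp only [dvd_mul_right, if_true, Nat.mul_div_cancel_left _ hq.pos, ha_def, hcpow]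
      ring
    · simp only [hdvd, if_false]
      ring
  have ha' : HasSum a ((1 + (q : ℂ) ^ ν) * ∑' m, d m -
      (q : ℂ) ^ ν * (q : ℂ) ^ (-s) * (l q * ∑' m, d m - (q : ℂ) ^ (-s) * ∑' m, a m)) := by
    refine ((hd.mul_left (1 + (q : ℂ) ^ ν)).sub
      (((hasSum_ite_dvd_iff hq0).2 he).mul_left ((q : ℂ) ^ ν * (q : ℂ) ^ (-s)))).congr_fun
      fun m ↦ ?_
    rcases eq_or_ne m 0 with rfl | hm
    · simp [ha_def, hd_def, he_def, csigma]
    simp only [ha_def, hd_def, csigma_prime_mul ν hq hm]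
    by_cases hdvd : q ∣ m
    · obtain ⟨m, rfl⟩ := hdvd
      simp only [dvd_mul_right, if_true, Nat.mul_div_cancel_left _ hq.pos, he_def, hcpow]
      ring
    · simp only [hdvd, if_false]
      ring
  have key := ha.unique ha'
  have hqC : (q : ℂ) ≠ 0 := Nat.cast_ne_zero.2 hq0
  rw [show ν - 2 * s = ν + -s + -s by ring, sub_eq_add_neg ν s, Complex.cpow_add _ _ hqC,
    Complex.cpow_add _ _ hqC]
  linear_combination key

lemma one_sub_natCast_cpow_ne_zero {q : ℕ} (hq : 1 < q) {w : ℂ} (hw : w.re < 0) :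
    1 - (q : ℂ) ^ w ≠ 0 := by
  intro h
  have h' : ‖(q : ℂ) ^ w‖ < 1 := by
    rw [Complex.norm_natCast_cpow_of_pos (by lia)]
    exact Real.rpow_lt_one_of_one_lt_of_neg (Nat.one_lt_cast.2 hq) hw
  rw [← sub_eq_zero.1 h, norm_one] at h'
  exact lt_irrefl _ h'

/-- First identity of the corrected Lemma 2.4(2): with oldform coefficients
`ρ n = τ₁ q^(1/2) l (n / q)` for `q ∣ n` (and `0` otherwise), for
`Re s > 1 + A + max 0 (Re ν)` one has
`∑_{n ≥ 1} ρ n σ_ν(n) n^(-s)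
  = τ₁ q^(1/2 - s) (1 + q^ν - l q q^(ν - s)) / (1 - q^(ν - 2s))
      * L(s) L(s - ν) / ζ(2s - ν)`. -/
theorem oldform_dirichlet_series_first (q : ℕ) (hq : q.Prime)
    (l : ℕ → ℂ) (C A : ℝ) (hC : 0 < C) (hA : 0 ≤ A)
    (h1 : l 1 = 1)
    (hmul : ∀ m n : ℕ, 1 ≤ m → 1 ≤ n → Nat.Coprime m n → l (m * n) = l m * l n)
    (hrec : ∀ p : ℕ, p.Prime → ∀ k : ℕ, 1 ≤ k →
      l (p ^ (k + 1)) = l p * l (p ^ k) - l (p ^ (k - 1)))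
    (hbd : ∀ n : ℕ, 1 ≤ n → ‖l n‖ ≤ C * (n : ℝ) ^ A)
    (ν : ℂ) (τ₁ : ℂ)
    (ρ : ℕ → ℂ)
    (hρ : ∀ n : ℕ, ρ n = if q ∣ n then τ₁ * (q : ℂ) ^ ((1 : ℂ) / 2) * l (n / q) else 0)
    (s : ℂ) (hs : 1 + A + max 0 ν.re < s.re) :
    (∑' n : ℕ, if n = 0 then 0 else ρ n * csigma ν n * (n : ℂ) ^ (-s)) =
      τ₁ * (q : ℂ) ^ ((1 : ℂ) / 2 - s) *
        ((1 + (q : ℂ) ^ ν - l q * (q : ℂ) ^ (ν - s)) / (1 - (q : ℂ) ^ (ν - 2 * s))) *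
        (Lfun l s * Lfun l (s - ν) / riemannZeta (2 * s - ν)) := by
  have hq0 := hq.ne_zero
  have hqC : (q : ℂ) ≠ 0 := Nat.cast_ne_zero.2 hq0
  have hden : 1 - (q : ℂ) ^ (ν - 2 * s) ≠ 0 := by
    refine one_sub_natCast_cpow_ne_zero hq.one_lt ?_
    have h0 := le_max_left 0 ν.re
    have hν := le_max_right 0 ν.re
    simp
    linarith
  have hsum := ((hasSum_ite_dvd_iff hq0).2
    (summable_mul_csigma_mul hbd hs hq0).hasSum).mul_left
      (τ₁ * (q : ℂ) ^ ((1 : ℂ) / 2) * (q : ℂ) ^ (-s))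
  have hterm (n : ℕ) : (if n = 0 then 0 else ρ n * csigma ν n * (n : ℂ) ^ (-s)) =
      τ₁ * (q : ℂ) ^ ((1 : ℂ) / 2) * (q : ℂ) ^ (-s) * (if q ∣ n then
        l (n / q) * csigma ν (q * (n / q)) * ((n / q : ℕ) : ℂ) ^ (-s) else 0) := by
    rw [hρ]
    by_cases hn : q ∣ n
    · obtain ⟨m, rfl⟩ := hn
      rcases eq_or_ne m 0 with rfl | hm
      · simp [csigma]
      rw [if_neg (mul_ne_zero hq0 hm), if_pos (dvd_mul_right q m), if_pos (dvd_mul_right q m),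
        Nat.mul_div_cancel_left _ hq.pos, Nat.cast_mul, Complex.natCast_mul_natCast_cpow]
      ring
    · simp [hn]
  rw [tsum_congr hterm, hsum.tsum_eq, ← tsum_mul_csigma hA h1 hmul hrec hbd hs,
    mul_assoc (τ₁ * _) (_ / _), div_mul_eq_mul_div,
    ← one_sub_mul_tsum_mul_csigma_prime_mul hq h1 hmul (hrec q hq) hbd hs,
    mul_div_cancel_left₀ _ hden, sub_eq_add_neg, Complex.cpow_add _ _ hqC]
  ring
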